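/- For all natural numbers n and m with n + 4 ≤ m ≤ 2n + 2, the coefficient of q^m in the q-binomial coefficient binom(n+4,4)_q equals p₄(m) - p₄(m-n-1) - p₄(m-n-2) - p₄(m-n-3) - p₄(m-n-4). -/

import Mathlib

open Polynomial

/-- The `q`-integer `[m]_q = 1 + q + q^2 + ⋯ + q^(m-1)` in `ℤ[q]`. -/
noncomputable def qInt (m : ℕ) : Polynomial ℤ := ∑ i ∈ Finset.range m, X ^ i

/-- The `q`-factorial `[m]!_q = [m]_q · [m-1]_q ⋯ [1]_q`, with `[0]!_q = 1`. -/
noncomputable def qFact : ℕ → Polynomial ℤ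
  | 0 => 1
  | m + 1 => qInt (m + 1) * qFact m

/-- `partnum k m = p_k(m)`, the number of partitions of `m` all of whose parts have size
at most `k`. -/
def partnum (k m : ℕ) : ℕ :=
  Fintype.card {p : Nat.Partition m // ∀ j ∈ p.parts, j ≤ k}

/-- `q`-integers are geometric sums. -/
lemma qInt_mul_one_sub (m : ℕ) : qInt m * (1 - X) = 1 - X ^ m :=
  geom_sum_mul_neg X m

lemma qInt_succ_ne_zero (m : ℕ) : qInt (m + 1) ≠ 0 := by
  intro h
  have := congrArg (fun p => p.coeff (m + 1)) (qInt_mul_one_sub (m + 1))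
  simp [h, coeff_one] at this

lemma qFact_ne_zero : ∀ n : ℕ, qFact n ≠ 0
  | 0 => one_ne_zero
  | n + 1 => mul_ne_zero (qInt_succ_ne_zero n) (qFact_ne_zero n)

lemma partnum_eq_card_restricted (k m : ℕ) :
    partnum k m = (Nat.Partition.restricted m (· ≤ k)).card :=
  Fintype.card_subtype _

open PowerSeries.WithPiTopology in
/-- The generating function of partitions into parts of size at most `k` is
`∏ 1 / (1 - q ^ i)` over `1 ≤ i ≤ k`. -/
lemma mk_partnum_mul_prod (k : ℕ) :
    (PowerSeries.mk fun m => (partnum k m : ℤ)) *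
      ∏ i ∈ Finset.range k, (1 - PowerSeries.X ^ (i + 1)) = 1 := by
  simp_rw [partnum_eq_card_restricted]
  rw [Nat.Partition.powerSeriesMk_card_restricted_eq_tprod,
    tprod_eq_prod (s := Finset.range k), ← Finset.prod_mul_distrib]
  · refine Finset.prod_eq_one fun i hi => ?_
    rw [if_pos (by simpa [Nat.succ_le_iff] using hi)]
    simp_rw [pow_mul]
    exact tsum_pow_mul_one_sub_of_constantCoeff_eq_zero (by simp)
  · intro i hi
    rw [if_neg (by simpa [Nat.succ_le_iff] using hi)]

/-- The product formula for a `q`-binomial coefficient `binom(n+4,4)_q`. -/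
lemma qbinom_four_mul_prod {n : ℕ} {P : Polynomial ℤ}
    (hP : P * qFact 4 * qFact n = qFact (n + 4)) :
    P * ∏ i ∈ Finset.range 4, (1 - X ^ (i + 1)) =
      ∏ i ∈ Finset.range 4, (1 - X ^ (n + (i + 1))) := by
  have h : P * (qInt 4 * qInt 3 * qInt 2 * qInt 1) =
      qInt (n + 4) * qInt (n + 3) * qInt (n + 2) * qInt (n + 1) := by
    apply mul_right_cancel₀ (qFact_ne_zero n)
    simp only [qFact] at hP
    linear_combination hP
  simp only [Finset.prod_range_succ, Finset.prod_range_zero, ← qInt_mul_one_sub]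
  linear_combination (1 - X) ^ 4 * h

/-- For `n + 4 ≤ m ≤ 2n + 2` the coefficient of `q^m` in `binom(n+4,4)_q` equals
`p₄(m) - p₄(m-n-1) - p₄(m-n-2) - p₄(m-n-3) - p₄(m-n-4)`. -/
theorem qbinom_coeff_yellow_region (n m : ℕ) (h₁ : n + 4 ≤ m) (h₂ : m ≤ 2 * n + 2)
    (P : Polynomial ℤ) (hP : P * qFact 4 * qFact n = qFact (n + 4)) :
    P.coeff m =
      (partnum 4 m : ℤ) - partnum 4 (m - n - 1) - partnum 4 (m - n - 2) -
        partnum 4 (m - n - 3) - partnum 4 (m - n - 4) := by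
  have hG := mk_partnum_mul_prod 4
  have hQ := congrArg (fun p : Polynomial ℤ => (p : PowerSeries ℤ)) (qbinom_four_mul_prod hP)
  simp only [Finset.prod_range_succ, Finset.prod_range_zero, Polynomial.coe_mul,
    Polynomial.coe_sub, Polynomial.coe_pow, Polynomial.coe_one, Polynomial.coe_X] at hG hQ
  set G : PowerSeries ℤ := PowerSeries.mk fun m => (partnum 4 m : ℤ) with hGdef
  have key : ∃ R : PowerSeries ℤ, (P : PowerSeries ℤ) =
      G - G * PowerSeries.X ^ (n + 1) - G * PowerSeries.X ^ (n + 2) - G * PowerSeries.X ^ (n + 3) -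
        G * PowerSeries.X ^ (n + 4) + R * PowerSeries.X ^ (2 * n + 3) := by
    let Y : PowerSeries ℤ := PowerSeries.X
    refine ⟨G * (1 + Y + 2 * Y ^ 2 + Y ^ 3 + Y ^ 4 - Y ^ n * (Y ^ 3 + Y ^ 4 + Y ^ 5 + Y ^ 6) +
      Y ^ (2 * n + 7)), ?_⟩
    linear_combination G * hQ - (P : PowerSeries ℤ) * hG
  obtain ⟨R, hR⟩ := key
  rw [← Polynomial.coeff_coe, hR]
  simp only [map_add, map_sub, PowerSeries.coeff_mul_X_pow', hGdef, PowerSeries.coeff_mk]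
  rw [if_pos (by omega), if_pos (by omega), if_pos (by omega), if_pos (by omega),
    if_neg (by omega), add_zero]
  simp only [Nat.sub_sub]
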